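/- arXiv:2508.08848 — 11 statements merged into one kernel-verified Lean document; each statement's English description precedes it below -/
import Mathlib

section
/- Under average-cost pricing: if (A·N − B)² − 4·A·F_a ≥ 0, then a point x ∈ (0, N) satisfies D(x) = 0 (i.e., c_n*(x, m + F_a/x) = c_a*(x, m + F_a/x)) if and only if x = N_{a1} or x = N_{a2}, and these satisfy 0 < N_{a1} ≤ N_{a2} < N (with N_{a1} < N_{a2} when the discriminant is strictly positive). If (A·N − B)² − 4·A·F_a < 0, then no x ∈ (0, N) satisfies D(x) = 0. -/
/-- Under average-cost pricing: if `(A·N − B)² − 4·A·F_a ≥ 0`, then a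
point `x ∈ (0, N)` satisfies `D(x) = 0` iff `x = N_{a1}` or `x = N_{a2}`, and
`0 < N_{a1} ≤ N_{a2} < N` (with `N_{a1} < N_{a2}` when the discriminant is strictly
positive). If the discriminant is negative, no `x ∈ (0, N)` satisfies `D(x) = 0`. -/
theorem stmt_1
    (β γ μ t_f F_n m F_a N θ κ : ℝ)
    (hβ : 0 < β) (hγ : 0 < γ) (hμ : 0 < μ) (hFa : 0 < F_a) (hN : 0 < N)
    (hθ0 : 0 < θ) (hθ1 : θ < 1) (hκ0 : 0 < κ) (hκ1 : κ < 1)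
    (A B : ℝ)
    (hA : A = β * γ * (1 - θ) / ((β + γ) * μ))
    (hB : B = θ * t_f + m - (t_f + F_n))
    (hB0 : 0 < B) (hBA : B < A * N)
    (D : ℝ → ℝ)
    (hD : ∀ x, D x = A * x + F_a / x - (A * N - B))
    (K Na1 Na2 : ℝ)
    (hK : K = Real.sqrt ((A * N - B) ^ 2 - 4 * A * F_a))
    (hNa1 : Na1 = (A * N - B - K) / (2 * A))
    (hNa2 : Na2 = (A * N - B + K) / (2 * A)) :
    ((A * N - B) ^ 2 - 4 * A * F_a ≥ 0 →
      (∀ x ∈ Set.Ioo (0 : ℝ) N, (D x = 0 ↔ x = Na1 ∨ x = Na2)) ∧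
      0 < Na1 ∧ Na1 ≤ Na2 ∧ Na2 < N ∧
      ((A * N - B) ^ 2 - 4 * A * F_a > 0 → Na1 < Na2)) ∧
    ((A * N - B) ^ 2 - 4 * A * F_a < 0 →
      ∀ x ∈ Set.Ioo (0 : ℝ) N, D x ≠ 0) := by
  have hA0 : 0 < A := by
    rw [hA]
    have : 0 < 1 - θ := by linarith
    positivity
  have hC : 0 < A * N - B := by linarith
  have hAF : 0 < A * F_a := mul_pos hA0 hFa
  have key : ∀ x, 0 < x → (D x = 0 ↔
      (2 * A * x - (A * N - B)) ^ 2 = (A * N - B) ^ 2 - 4 * A * F_a) := by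
    intro x hx
    have h1 : D x * x = A * x ^ 2 + F_a - (A * N - B) * x := by
      rw [hD]
      field_simp
    constructor
    · intro h
      rw [h] at h1
      linear_combination (-4 * A) * h1
    · intro h
      have h2 : (4 * A * x) * D x = 0 := by linear_combination (4 * A) * h1 + h
      have h3 : 4 * A * x ≠ 0 := by positivity
      exact (mul_eq_zero.mp h2).resolve_left h3
  constructor
  · intro hdisc
    have hK0 : 0 ≤ K := by rw [hK]; exact Real.sqrt_nonneg _
    have hK2 : K ^ 2 = (A * N - B) ^ 2 - 4 * A * F_a := by
      rw [hK]; exact Real.sq_sqrt hdisc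
    have hKC : K < A * N - B := by
      apply lt_of_pow_lt_pow_left₀ 2 hC.le
      linarith
    have h2A : 0 < 2 * A := by linarith
    refine ⟨?_, ?_, ?_, ?_, ?_⟩
    · rintro x ⟨hx, -⟩
      rw [key x hx, ← hK2, sq_eq_sq_iff_eq_or_eq_neg, hNa1, hNa2,
        eq_div_iff h2A.ne', eq_div_iff h2A.ne']
      constructor
      · rintro (h | h)
        · right; linarith
        · left; linarith
      · rintro (h | h)
        · right; linarith
        · left; linarith
    · rw [hNa1]; exact div_pos (by linarith) h2A
    · rw [hNa1, hNa2]; exact div_le_div_of_nonneg_right (by linarith) h2A.le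
    · rw [hNa2, div_lt_iff₀ h2A]; linarith
    · intro h
      have hKp : 0 < K := by rw [hK]; exact Real.sqrt_pos.mpr h
      rw [hNa1, hNa2]; exact div_lt_div_of_pos_right (by linarith) h2A
  · rintro hdisc x ⟨hx, -⟩ h
    have h1 := (key x hx).mp h
    have h2 := sq_nonneg (2 * A * x - (A * N - B))
    linarith
end

section
/- Assume (A·N − B)² − 4·A·F_a ≥ 0. Then the equilibrium SAV ridership levels under the three fare-setting scenarios satisfy N_a^MC > N_{a2} ≥ N_a^m ≥ N_{a1} > 0, where N_a^MC := (A·N − B)/A, N_a^m := (A·N − B)/(2A), N_{a1} := (A·N − B − K)/(2A), N_{a2} := (A·N − B + K)/(2A), K := √((A·N − B)² − 4·A·F_a). Moreover, if (A·N − B)² − 4·A·F_a > 0 then all displayed inequalities are strict. -/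
/-- Assume `(A·N − B)² − 4·A·F_a ≥ 0`. Then the equilibrium SAV
ridership levels satisfy `N_a^MC > N_{a2} ≥ N_a^m ≥ N_{a1} > 0`; moreover, if
the discriminant is strictly positive then all inequalities are strict. -/
theorem stmt_6
    (β γ μ t_f F_n m F_a N θ κ : ℝ)
    (hβ : 0 < β) (hγ : 0 < γ) (hμ : 0 < μ) (hFa : 0 < F_a) (hN : 0 < N)
    (hθ0 : 0 < θ) (hθ1 : θ < 1) (hκ0 : 0 < κ) (hκ1 : κ < 1)
    (A B : ℝ)
    (hA : A = β * γ * (1 - θ) / ((β + γ) * μ))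
    (hB : B = θ * t_f + m - (t_f + F_n))
    (hB0 : 0 < B) (hBA : B < A * N)
    (K NaMC Nam Na1 Na2 : ℝ)
    (hK : K = Real.sqrt ((A * N - B) ^ 2 - 4 * A * F_a))
    (hNaMC : NaMC = (A * N - B) / A)
    (hNam : Nam = (A * N - B) / (2 * A))
    (hNa1 : Na1 = (A * N - B - K) / (2 * A))
    (hNa2 : Na2 = (A * N - B + K) / (2 * A))
    (hdisc : (A * N - B) ^ 2 - 4 * A * F_a ≥ 0) :
    (NaMC > Na2 ∧ Na2 ≥ Nam ∧ Nam ≥ Na1 ∧ Na1 > 0) ∧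
    ((A * N - B) ^ 2 - 4 * A * F_a > 0 →
      NaMC > Na2 ∧ Na2 > Nam ∧ Nam > Na1 ∧ Na1 > 0) := by
  have hA0 : 0 < A := by
    by_contra h
    push Not at h
    have := mul_nonpos_of_nonpos_of_nonneg h hN.le
    linarith
  have h2A : 0 < 2 * A := by linarith
  have hK0 : 0 ≤ K := by rw [hK]; exact Real.sqrt_nonneg _
  have hKlt : K < A * N - B := by
    rw [hK, Real.sqrt_lt' (by linarith)]
    have := mul_pos hA0 hFa
    linarith
  have e : NaMC = (2 * (A * N - B)) / (2 * A) := by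
    rw [hNaMC, mul_div_mul_left _ _ (two_ne_zero)]
  have h1 : NaMC > Na2 := by
    rw [e, hNa2]; exact div_lt_div_of_pos_right (by linarith) h2A
  have h4 : Na1 > 0 := by
    rw [hNa1]; exact div_pos (by linarith) h2A
  refine ⟨⟨h1, ?_, ?_, h4⟩, fun hd => ?_⟩
  · rw [hNa2, hNam]; exact div_le_div_of_nonneg_right (by linarith) h2A.le
  · rw [hNa1, hNam]; exact div_le_div_of_nonneg_right (by linarith) h2A.le
  · have hKp : 0 < K := by rw [hK]; exact Real.sqrt_pos.mpr hd
    refine ⟨h1, ?_, ?_, h4⟩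
    · rw [hNa2, hNam]; exact div_lt_div_of_pos_right (by linarith) h2A
    · rw [hNa1, hNam]; exact div_lt_div_of_pos_right (by linarith) h2A
end

section
/- Assume (A·N − B)² − 4·A·F_a ≥ 0. Then the equilibrium commuting costs satisfy c^MC < c_2 ≤ c^m ≤ c_1 < c_0, where c(x) := (A/(1−θ))·(N − (1−κ)·x) + t_f + F_n, c^MC := c((A·N − B)/A), c^m := c((A·N − B)/(2A)), c_1 := c((A·N − B − K)/(2A)), c_2 := c((A·N − B + K)/(2A)), c_0 := c(0), and K := √((A·N − B)² − 4·A·F_a). If (A·N − B)² − 4·A·F_a > 0 then all displayed inequalities are strict. -/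
/-- Assume `(A·N − B)² − 4·A·F_a ≥ 0`. Then the equilibrium
commuting costs satisfy `c^MC < c_2 ≤ c^m ≤ c_1 < c_0`, with all inequalities
strict when the discriminant is strictly positive. -/
theorem stmt_7
    (β γ μ t_f F_n m F_a N θ κ : ℝ)
    (hβ : 0 < β) (hγ : 0 < γ) (hμ : 0 < μ) (hFa : 0 < F_a) (hN : 0 < N)
    (hθ0 : 0 < θ) (hθ1 : θ < 1) (hκ0 : 0 < κ) (hκ1 : κ < 1)
    (A B : ℝ)
    (hA : A = β * γ * (1 - θ) / ((β + γ) * μ))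
    (hB : B = θ * t_f + m - (t_f + F_n))
    (hB0 : 0 < B) (hBA : B < A * N)
    (c : ℝ → ℝ)
    (hc : ∀ x, c x = (A / (1 - θ)) * (N - (1 - κ) * x) + t_f + F_n)
    (K cMC cm c1 c2 c0 : ℝ)
    (hK : K = Real.sqrt ((A * N - B) ^ 2 - 4 * A * F_a))
    (hcMC : cMC = c ((A * N - B) / A))
    (hcm : cm = c ((A * N - B) / (2 * A)))
    (hc1 : c1 = c ((A * N - B - K) / (2 * A)))
    (hc2 : c2 = c ((A * N - B + K) / (2 * A)))
    (hc0 : c0 = c 0)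
    (hdisc : (A * N - B) ^ 2 - 4 * A * F_a ≥ 0) :
    (cMC < c2 ∧ c2 ≤ cm ∧ cm ≤ c1 ∧ c1 < c0) ∧
    ((A * N - B) ^ 2 - 4 * A * F_a > 0 →
      cMC < c2 ∧ c2 < cm ∧ cm < c1 ∧ c1 < c0) := by
  have h1θ : 0 < 1 - θ := by linarith
  have hA0 : 0 < A := by rw [hA]; positivity
  have hκ' : 0 < 1 - κ := by linarith
  have hD : 0 < A / (1 - θ) := by positivity
  have anti : StrictAnti c := by
    intro x y hxy
    rw [hc, hc]
    have h1 : (1 - κ) * x < (1 - κ) * y := mul_lt_mul_of_pos_left hxy hκ'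
    have h2 : A / (1 - θ) * (N - (1 - κ) * y) < A / (1 - θ) * (N - (1 - κ) * x) :=
      mul_lt_mul_of_pos_left (by linarith) hD
    linarith
  have hK0 : 0 ≤ K := by rw [hK]; exact Real.sqrt_nonneg _
  have hE : 0 < A * N - B := by linarith
  have hKE : K < A * N - B := by
    rw [hK, Real.sqrt_lt' hE]
    have : 0 < A * F_a := by positivity
    linarith
  have h2A : 0 < 2 * A := by linarith
  have e : (A * N - B) / A = (2 * (A * N - B)) / (2 * A) := by
    rw [mul_div_mul_left _ _ (by norm_num : (2 : ℝ) ≠ 0)]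
  have i1 : cMC < c2 := by
    rw [hcMC, hc2, e]
    exact anti (div_lt_div_of_pos_right (by linarith) h2A)
  have i4 : c1 < c0 := by
    rw [hc1, hc0]
    exact anti (div_pos (by linarith) h2A)
  refine ⟨⟨i1, ?_, ?_, i4⟩, fun hp => ⟨i1, ?_, ?_, i4⟩⟩
  · rw [hc2, hcm]
    exact anti.antitone (div_le_div_of_nonneg_right (by linarith) h2A.le)
  · rw [hc1, hcm]
    exact anti.antitone (div_le_div_of_nonneg_right (by linarith) h2A.le)
  · have hKp : 0 < K := by rw [hK]; exact Real.sqrt_pos.mpr hp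
    rw [hc2, hcm]
    exact anti (div_lt_div_of_pos_right (by linarith) h2A)
  · have hKp : 0 < K := by rw [hK]; exact Real.sqrt_pos.mpr hp
    rw [hc1, hcm]
    exact anti (div_lt_div_of_pos_right (by linarith) h2A)
end

section
/- Fix μ₀ > 0, let A₀ := A(μ₀), and assume 0 < B < A₀·N and (A₀·N − B)² − 4·A₀·F_a > 0. If N − (1−κ)·( N/2 + ((A₀·N − B)·A₀·N − 2·A₀·F_a)/(2·A₀·√((A₀·N − B)² − 4·A₀·F_a)) ) < 0, then the function μ ↦ c_2(μ) := ((1+κ)·A(μ)·N + (1−κ)·B − (1−κ)·√((A(μ)·N − B)² − 4·A(μ)·F_a))/(2·(1−θ)) + t_f + F_n has a strictly positive derivative at μ₀. (Downs–Thomson paradox: expanding capacity strictly increases the equilibrium commuting cost at the high-adoption average-cost-pricing equilibrium.) -/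
/-- Downs–Thomson paradox: Fix `μ₀ > 0`, let `A₀ := A(μ₀)`, and
assume `0 < B < A₀·N` and `(A₀·N − B)² − 4·A₀·F_a > 0`. If
`N − (1−κ)·(N/2 + ((A₀·N − B)·A₀·N − 2·A₀·F_a)/(2·A₀·√((A₀·N − B)² − 4·A₀·F_a))) < 0`,
then the commuting cost at the high-adoption average-cost-pricing equilibrium,
as a function of capacity, has a strictly positive derivative at `μ₀`. -/
theorem stmt_9
    (β γ t_f F_n m F_a N θ κ : ℝ)
    (hβ : 0 < β) (hγ : 0 < γ) (hFa : 0 < F_a) (hN : 0 < N)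
    (hθ0 : 0 < θ) (hθ1 : θ < 1) (hκ0 : 0 < κ) (hκ1 : κ < 1)
    (B : ℝ) (hB : B = θ * t_f + m - (t_f + F_n))
    (Afun : ℝ → ℝ)
    (hAfun : ∀ μ, Afun μ = β * γ * (1 - θ) / ((β + γ) * μ))
    (c2 : ℝ → ℝ)
    (hc2 : ∀ μ, c2 μ =
      ((1 + κ) * Afun μ * N + (1 - κ) * B -
        (1 - κ) * Real.sqrt ((Afun μ * N - B) ^ 2 - 4 * Afun μ * F_a)) /
        (2 * (1 - θ)) + t_f + F_n)
    (μ₀ A₀ : ℝ) (hμ₀ : 0 < μ₀) (hA₀ : A₀ = Afun μ₀)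
    (hB0 : 0 < B) (hBA : B < A₀ * N)
    (hdisc : (A₀ * N - B) ^ 2 - 4 * A₀ * F_a > 0)
    (hpara : N - (1 - κ) * (N / 2 +
      ((A₀ * N - B) * A₀ * N - 2 * A₀ * F_a) /
        (2 * A₀ * Real.sqrt ((A₀ * N - B) ^ 2 - 4 * A₀ * F_a))) < 0) :
    ∃ d : ℝ, 0 < d ∧ HasDerivAt c2 d μ₀ := by
  have h1θ : 0 < 1 - θ := by linarith
  have hA0pos : 0 < A₀ := by
    rw [hA₀, hAfun]; positivity
  have hA' : HasDerivAt Afun (-(A₀ / μ₀)) μ₀ := by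
    have hfun : Afun = fun μ => (β * γ * (1 - θ) / (β + γ)) * μ⁻¹ := by
      funext μ
      rw [hAfun, ← div_div, div_eq_mul_inv _ μ]
    have h := (hasDerivAt_inv hμ₀.ne').const_mul (β * γ * (1 - θ) / (β + γ))
    rw [hA₀, hAfun]
    rw [hfun]
    refine h.congr_deriv ?_
    field_simp
  set D := (A₀ * N - B) ^ 2 - 4 * A₀ * F_a with hD
  have hs : 0 < Real.sqrt D := Real.sqrt_pos.mpr hdisc
  have hDd : HasDerivAt (fun μ => (Afun μ * N - B) ^ 2 - 4 * Afun μ * F_a)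
      (2 * (A₀ * N - B) * (-(A₀ / μ₀) * N) - 4 * (-(A₀ / μ₀)) * F_a) μ₀ := by
    have h := (((hA'.mul_const N).sub_const B).pow 2).sub ((hA'.const_mul 4).mul_const F_a)
    rw [hA₀] at h ⊢
    refine HasDerivAt.congr_deriv h ?_
    norm_num
  have hDe : (Afun μ₀ * N - B) ^ 2 - 4 * Afun μ₀ * F_a = D := by rw [hD, hA₀]
  have hsq := hDd.sqrt (by rw [hDe]; exact hdisc.ne')
  rw [hDe] at hsq
  have hc := (((((((hA'.const_mul (1 + κ)).mul_const N).add_const ((1 - κ) * B)).sub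
    (hsq.const_mul (1 - κ))).div_const (2 * (1 - θ))).add_const t_f).add_const F_n)
  refine ⟨_, ?_, hc.congr_of_eventuallyEq (Filter.Eventually.of_forall fun μ => hc2 μ)⟩
  have key : ((1 + κ) * -(A₀ / μ₀) * N - (1 - κ) *
      ((2 * (A₀ * N - B) * (-(A₀ / μ₀) * N) - 4 * (-(A₀ / μ₀)) * F_a) / (2 * Real.sqrt D)))
        / (2 * (1 - θ))
      = (A₀ / μ₀ / (1 - θ)) * -(N - (1 - κ) * (N / 2 +
      ((A₀ * N - B) * A₀ * N - 2 * A₀ * F_a) / (2 * A₀ * Real.sqrt D))) := by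
    generalize Real.sqrt D = s at hs
    field_simp
    ring
  rw [key]
  exact mul_pos (by positivity) (by linarith)
end

section
/- Let s(t) := max(−β·t, γ·t). Suppose n_n, n_a, τ : ℝ → ℝ and a constant c* ∈ ℝ satisfy: for every t ∈ ℝ, if n_n(t) > 0 then s(t) + t_f + F_n + τ(t) = c*, and if n_a(t) > 0 then s(t) + θ·t_f + m + κ·τ(t) = c*. Then the set {t ∈ ℝ : n_n(t) > 0 and n_a(t) > 0} has Lebesgue measure zero (indeed it contains at most two points). -/
/-- Let `s(t) := max(−β·t, γ·t)`. Suppose `n_n, n_a, τ : ℝ → ℝ`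
and a constant `c* ∈ ℝ` satisfy: for every `t`, if `n_n(t) > 0` then
`s(t) + t_f + F_n + τ(t) = c*`, and if `n_a(t) > 0` then
`s(t) + θ·t_f + m + κ·τ(t) = c*`. Then the set
`{t : n_n(t) > 0 ∧ n_a(t) > 0}` has Lebesgue measure zero; indeed it contains
at most two points. -/
theorem stmt_10
    (β γ t_f F_n m θ κ : ℝ)
    (hβ : 0 < β) (hγ : 0 < γ)
    (hθ0 : 0 < θ) (hθ1 : θ < 1) (hκ0 : 0 < κ) (hκ1 : κ < 1)
    (s : ℝ → ℝ) (hs : ∀ t, s t = max (-β * t) (γ * t))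
    (n_n n_a τ : ℝ → ℝ) (cstar : ℝ)
    (hn : ∀ t, 0 < n_n t → s t + t_f + F_n + τ t = cstar)
    (ha : ∀ t, 0 < n_a t → s t + θ * t_f + m + κ * τ t = cstar) :
    MeasureTheory.volume {t : ℝ | 0 < n_n t ∧ 0 < n_a t} = 0 ∧
    ∃ a b : ℝ, {t : ℝ | 0 < n_n t ∧ 0 < n_a t} ⊆ {a, b} := by
  have key : ∃ a b : ℝ, {t : ℝ | 0 < n_n t ∧ 0 < n_a t} ⊆ {a, b} := by
    obtain ⟨S, hS⟩ : ∃ S, S = (cstar - θ * t_f - m - κ * (cstar - t_f - F_n)) / (1 - κ) := ⟨_, rfl⟩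
    have h1 : (1 - κ) ≠ 0 := by linarith
    refine ⟨-S / β, S / γ, ?_⟩
    rintro t ⟨h, h'⟩
    have e1 := hn t h
    have e2 := ha t h'
    have e3 : τ t = cstar - s t - t_f - F_n := by linarith
    have e : s t = S := by
      rw [hS, eq_div_iff h1]
      rw [e3] at e2
      linear_combination e2
    rw [hs] at e
    simp only [Set.mem_insert_iff, Set.mem_singleton_iff]
    rcases max_choice (-β * t) (γ * t) with hm | hm
    · left
      rw [eq_div_iff hβ.ne']
      linarith
    · right
      rw [eq_div_iff hγ.ne']
      linarith
  refine ⟨?_, key⟩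
  obtain ⟨a, b, hab⟩ := key
  exact ((Set.toFinite {a, b}).subset hab).measure_zero _
end

section
/- Assume η := (1−κ)/(1−θ) ≥ 1 and (A·N − B)² − 4·A·F_a ≥ 0. Then η·A·N > B (so the first-best equilibrium uses both NVs and SAVs), c^MC − c^FB_1 = (η − 1)·B ≥ 0, and the chain c^FB_1 ≤ c^MC < c_2 ≤ c^m < c_0 holds, where c^FB_1 := κ·A·N/(1−θ) + B + t_f + F_n is the first-best equilibrium commuting cost. Hence the first-best policy weakly lowers every commuter's cost relative to the equilibrium under any of the three fare-setting scenarios. -/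
/-- Assume `η := (1−κ)/(1−θ) ≥ 1` and `(A·N − B)² − 4·A·F_a ≥ 0`.
Then `η·A·N > B` (the first-best equilibrium uses both NVs and SAVs),
`c^MC − c^FB_1 = (η − 1)·B ≥ 0`, and `c^FB_1 ≤ c^MC < c_2 ≤ c^m < c_0`, where
`c^FB_1 := κ·A·N/(1−θ) + B + t_f + F_n` is the first-best equilibrium cost. -/
theorem stmt_11
    (β γ μ t_f F_n m F_a N θ κ : ℝ)
    (hβ : 0 < β) (hγ : 0 < γ) (hμ : 0 < μ) (hFa : 0 < F_a) (hN : 0 < N)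
    (hθ0 : 0 < θ) (hθ1 : θ < 1) (hκ0 : 0 < κ) (hκ1 : κ < 1)
    (A B : ℝ)
    (hA : A = β * γ * (1 - θ) / ((β + γ) * μ))
    (hB : B = θ * t_f + m - (t_f + F_n))
    (hB0 : 0 < B) (hBA : B < A * N)
    (η : ℝ) (hη : η = (1 - κ) / (1 - θ)) (hη1 : η ≥ 1)
    (hdisc : (A * N - B) ^ 2 - 4 * A * F_a ≥ 0)
    (K : ℝ) (hK : K = Real.sqrt ((A * N - B) ^ 2 - 4 * A * F_a))
    (c : ℝ → ℝ)
    (hc : ∀ x, c x = (A / (1 - θ)) * (N - (1 - κ) * x) + t_f + F_n)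
    (cMC cm c2 c0 cFB1 : ℝ)
    (hcMC : cMC = c ((A * N - B) / A))
    (hcm : cm = c ((A * N - B) / (2 * A)))
    (hc2 : c2 = c ((A * N - B + K) / (2 * A)))
    (hc0 : c0 = c 0)
    (hcFB1 : cFB1 = κ * A * N / (1 - θ) + B + t_f + F_n) :
    η * A * N > B ∧
    cMC - cFB1 = (η - 1) * B ∧ (η - 1) * B ≥ 0 ∧
    cFB1 ≤ cMC ∧ cMC < c2 ∧ c2 ≤ cm ∧ cm < c0 := by
  have hθ : 0 < 1 - θ := by linarith
  have hApos : 0 < A := by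
    rw [hA]; positivity
  have hη0 : 0 < η := by linarith
  have hK0 : 0 ≤ K := by rw [hK]; exact Real.sqrt_nonneg _
  have hD : 0 < A * N - B := by linarith
  have hKlt : K < A * N - B := by
    rw [hK, Real.sqrt_lt' hD]
    have : 0 < A * F_a := mul_pos hApos hFa
    linarith
  have e : ∀ y, c (y / A) = A * N / (1 - θ) - η * y + t_f + F_n := by
    intro y
    rw [hc, hη]
    field_simp
  have e2 : ∀ y, c (y / (2 * A)) = A * N / (1 - θ) - η * (y / 2) + t_f + F_n := by
    intro y
    rw [← e]
    congr 1
    field_simp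
  have e0 : c 0 = A * N / (1 - θ) + t_f + F_n := by
    have := e 0
    simpa using this
  rw [e] at hcMC
  rw [e2] at hcm hc2
  rw [e0] at hc0
  have h1 : κ * A * N / (1 - θ) = A * N / (1 - θ) - η * (A * N) := by
    rw [hη]; field_simp; ring
  have hnn : 0 ≤ (η - 1) * B := mul_nonneg (by linarith) hB0.le
  have hd : cMC - cFB1 = (η - 1) * B := by
    rw [hcMC, hcFB1, h1]; ring
  have p1 : 0 ≤ (η - 1) * (A * N) := mul_nonneg (by linarith) (by linarith)
  have p2 : 0 < η * (A * N - B - K) := mul_pos hη0 (by linarith)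
  have p3 : 0 ≤ η * K := mul_nonneg hη0.le hK0
  have p4 : 0 < η * (A * N - B) := mul_pos hη0 hD
  refine ⟨by nlinarith, hd, hnn, by linarith, ?_, ?_, ?_⟩
  · rw [hcMC, hc2]; linarith
  · rw [hcm, hc2]; linarith
  · rw [hcm, hc0]; linarith
end

section
/- Assume η := (1−κ)/(1−θ) ≥ 1 and (A·N − B)² − 4·A·F_a ≥ 0. Then the SAV ridership levels satisfy N_a^SB > N_a^MC > N_{a2} ≥ N_a^m > 0, where N_a^SB := (A·(1+η)·N − B)/(2A) is the second-best level, N_a^MC := (A·N − B)/A is the marginal-cost-pricing level, N_{a2} := (A·N − B + √((A·N − B)² − 4·A·F_a))/(2A) is the high-adoption average-cost-pricing level, and N_a^m := (A·N − B)/(2A) is the monopoly level. -/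
/-- Assume `η := (1−κ)/(1−θ) ≥ 1` and `(A·N − B)² − 4·A·F_a ≥ 0`.
Then the SAV ridership levels satisfy `N_a^SB > N_a^MC > N_{a2} ≥ N_a^m > 0`. -/
theorem stmt_15
    (β γ μ t_f F_n m F_a N θ κ : ℝ)
    (hβ : 0 < β) (hγ : 0 < γ) (hμ : 0 < μ) (hFa : 0 < F_a) (hN : 0 < N)
    (hθ0 : 0 < θ) (hθ1 : θ < 1) (hκ0 : 0 < κ) (hκ1 : κ < 1)
    (A B : ℝ)
    (hA : A = β * γ * (1 - θ) / ((β + γ) * μ))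
    (hB : B = θ * t_f + m - (t_f + F_n))
    (hB0 : 0 < B) (hBA : B < A * N)
    (η : ℝ) (hη : η = (1 - κ) / (1 - θ)) (hη1 : η ≥ 1)
    (hdisc : (A * N - B) ^ 2 - 4 * A * F_a ≥ 0)
    (NaSB NaMC Na2 Nam : ℝ)
    (hNaSB : NaSB = (A * (1 + η) * N - B) / (2 * A))
    (hNaMC : NaMC = (A * N - B) / A)
    (hNa2 : Na2 = (A * N - B + Real.sqrt ((A * N - B) ^ 2 - 4 * A * F_a)) / (2 * A))
    (hNam : Nam = (A * N - B) / (2 * A)) :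
    NaSB > NaMC ∧ NaMC > Na2 ∧ Na2 ≥ Nam ∧ Nam > 0 := by
  have hA0 : 0 < A := by
    by_contra h
    have : A * N ≤ 0 := mul_nonpos_of_nonpos_of_nonneg (not_lt.mp h) hN.le
    linarith
  have hAN : 0 < A * N := mul_pos hA0 hN
  have h2A : 0 < 2 * A := by linarith
  have hAF : 0 < A * F_a := mul_pos hA0 hFa
  have hs0 := Real.sqrt_nonneg ((A * N - B) ^ 2 - 4 * A * F_a)
  have hs1 : Real.sqrt ((A * N - B) ^ 2 - 4 * A * F_a) < A * N - B := by
    rw [Real.sqrt_lt' (by linarith)]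
    linarith
  have hMC : NaMC = (2 * (A * N - B)) / (2 * A) := by
    rw [hNaMC]
    field_simp
  have hηN : A * N * 1 ≤ A * N * η := mul_le_mul_of_nonneg_left hη1 hAN.le
  refine ⟨?_, ?_, ?_, ?_⟩
  · rw [hMC, hNaSB]
    exact div_lt_div_of_pos_right (by linarith) h2A
  · rw [hMC, hNa2]
    exact div_lt_div_of_pos_right (by linarith) h2A
  · rw [hNa2, hNam]
    exact div_le_div_of_nonneg_right (by linarith) h2A.le
  · rw [hNam]
    exact div_pos (by linarith) h2A
end

section
/- Assume η := (1−κ)/(1−θ) ≥ 1 and N > N_min. Then the social costs satisfy SC^MC < SC_2 < SC^m < SC_0. -/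
/-- Assume `η := (1−κ)/(1−θ) ≥ 1` and `N > N_min`. Then the
social costs satisfy `SC^MC < SC_2 < SC^m < SC_0`. -/
theorem stmt_16
    (β γ μ t_f F_n m F_a N θ κ : ℝ)
    (hβ : 0 < β) (hγ : 0 < γ) (hμ : 0 < μ) (hFa : 0 < F_a) (hN : 0 < N)
    (hθ0 : 0 < θ) (hθ1 : θ < 1) (hκ0 : 0 < κ) (hκ1 : κ < 1)
    (A B : ℝ)
    (hA : A = β * γ * (1 - θ) / ((β + γ) * μ))
    (hB : B = θ * t_f + m - (t_f + F_n))
    (hB0 : 0 < B) (hBA : B < A * N)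
    (η : ℝ) (hη : η = (1 - κ) / (1 - θ)) (hη1 : η ≥ 1)
    (Nmin : ℝ) (hNmin : Nmin = (B + 2 * Real.sqrt (A * F_a)) / A)
    (hNlarge : N > Nmin)
    (K : ℝ) (hK : K = Real.sqrt ((A * N - B) ^ 2 - 4 * A * F_a))
    (c : ℝ → ℝ)
    (hc : ∀ x, c x = (A / (1 - θ)) * (N - (1 - κ) * x) + t_f + F_n)
    (SCMC SC2 SCm SC0 : ℝ)
    (hSCMC : SCMC = N * c ((A * N - B) / A) + F_a)
    (hSC2 : SC2 = N * c ((A * N - B + K) / (2 * A)))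
    (hSCm : SCm = N * c ((A * N - B) / (2 * A)) - (A * N - B) ^ 2 / (4 * A) + F_a)
    (hSC0 : SC0 = N * c 0 + F_a) :
    SCMC < SC2 ∧ SC2 < SCm ∧ SCm < SC0 := by
  have h1 : 0 < 1 - θ := by linarith
  have hA0 : 0 < A := by rw [hA]; positivity
  have hcx : ∀ x, N * c x = N * (A / (1 - θ) * N + t_f + F_n) - (η * N) * (A * x) := by
    intro x
    rw [hc, hη]
    field_simp
    ring
  obtain ⟨D, hD⟩ : ∃ D, D = A * N - B := ⟨_, rfl⟩
  obtain ⟨P, hP⟩ : ∃ P, P = η * N := ⟨_, rfl⟩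
  have hPN : N ≤ P := by rw [hP]; nlinarith
  have hD0 : 0 < D := by linarith
  have hDP : D < A * P := by
    have := mul_le_mul_of_nonneg_left hPN hA0.le
    linarith only [this, hD, hB0]
  have hs0 : 0 < A * F_a := by positivity
  have hs : 2 * Real.sqrt (A * F_a) < D := by
    have : (B + 2 * Real.sqrt (A * F_a)) / A < N := by rw [← hNmin]; exact hNlarge
    rw [div_lt_iff₀ hA0] at this
    linarith
  have hsq : Real.sqrt (A * F_a) ^ 2 = A * F_a := Real.sq_sqrt hs0.le
  have hdisc : 0 < D ^ 2 - 4 * A * F_a := by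
    have := Real.sqrt_nonneg (A * F_a)
    nlinarith
  rw [← hD] at hK hSCMC hSC2 hSCm
  have hK0 : 0 < K := by rw [hK]; exact Real.sqrt_pos.mpr hdisc
  have hK2 : K ^ 2 = D ^ 2 - 4 * A * F_a := by rw [hK]; exact Real.sq_sqrt hdisc.le
  have hKD : K < D := by
    apply lt_of_pow_lt_pow_left₀ 2 hD0.le
    linarith only [hK2, hs0]
  have e1 : A * (D / A) = D := by field_simp
  have e2 : A * ((D + K) / (2 * A)) = (D + K) / 2 := by field_simp
  have e3 : A * (D / (2 * A)) = D / 2 := by field_simp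
  obtain ⟨Q, hQ⟩ : ∃ Q, Q = D ^ 2 / (4 * A) := ⟨_, rfl⟩
  have hQA : 4 * A * Q = D ^ 2 := by rw [hQ]; field_simp
  rw [hcx, ← hP, e1] at hSCMC
  rw [hcx, ← hP, e2] at hSC2
  rw [hcx, ← hP, e3, ← hQ] at hSCm
  rw [hcx, ← hP] at hSC0
  have g1 : F_a < P * (D - K) / 2 := by
    have : A * F_a < A * (P * (D - K) / 2) := by
      have u1 := mul_pos (sub_pos.mpr hKD) (sub_pos.mpr hDP)
      have u2 := mul_pos (sub_pos.mpr hKD) (sub_pos.mpr hKD)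
      linarith only [u1, u2, hK2]
    exact lt_of_mul_lt_mul_left this hA0.le
  have g2 : Q - F_a < P * K / 2 := by
    have : A * (Q - F_a) < A * (P * K / 2) := by
      have u1 := mul_pos hK0 (sub_pos.mpr hDP)
      have u2 := mul_pos hK0 (sub_pos.mpr hKD)
      have u3 := mul_pos hK0 hK0
      linarith only [u1, u2, u3, hK2, hQA]
    exact lt_of_mul_lt_mul_left this hA0.le
  have g3 : 0 < Q := by rw [hQ]; positivity
  have g4 : 0 < P * D := mul_pos (by linarith) hD0
  refine ⟨?_, ?_, ?_⟩
  · rw [hSCMC, hSC2]; linarith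
  · rw [hSC2, hSCm]; linarith
  · rw [hSCm, hSC0]; linarith
end

section
/- Assume 1/2 ≤ η < 1 where η := (1−κ)/(1−θ), and let N_c^{MC=AC} := (η·B + √(η²·B² + 4·η·(1−η)·A·F_a))/(2·η·(1−η)·A). Then: if N_min < N < N_c^{MC=AC} then SC^MC < SC_2 < SC^m < SC_0; if N = N_c^{MC=AC} then SC^MC = SC_2 < SC^m < SC_0; and if N > N_c^{MC=AC} then SC_2 < SC^MC < SC^m < SC_0. -/
set_option maxHeartbeats 2000000

/-- Assume `1/2 ≤ η < 1` with `η := (1−κ)/(1−θ)`, and let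
`N_c^{MC=AC} := (η·B + √(η²·B² + 4·η·(1−η)·A·F_a))/(2·η·(1−η)·A)`. Then:
if `N_min < N < N_c^{MC=AC}` then `SC^MC < SC_2 < SC^m < SC_0`;
if `N = N_c^{MC=AC}` then `SC^MC = SC_2 < SC^m < SC_0`;
and if `N > N_c^{MC=AC}` then `SC_2 < SC^MC < SC^m < SC_0`. -/
theorem stmt_17
    (β γ μ t_f F_n m F_a N θ κ : ℝ)
    (hβ : 0 < β) (hγ : 0 < γ) (hμ : 0 < μ) (hFa : 0 < F_a) (hN : 0 < N)
    (hθ0 : 0 < θ) (hθ1 : θ < 1) (hκ0 : 0 < κ) (hκ1 : κ < 1)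
    (A B : ℝ)
    (hA : A = β * γ * (1 - θ) / ((β + γ) * μ))
    (hB : B = θ * t_f + m - (t_f + F_n))
    (hB0 : 0 < B) (hBA : B < A * N)
    (η : ℝ) (hη : η = (1 - κ) / (1 - θ)) (hη1 : 1 / 2 ≤ η) (hη2 : η < 1)
    (Nmin : ℝ) (hNmin : Nmin = (B + 2 * Real.sqrt (A * F_a)) / A)
    (hNlarge : N > Nmin)
    (Nc : ℝ)
    (hNc : Nc = (η * B + Real.sqrt (η ^ 2 * B ^ 2 + 4 * η * (1 - η) * A * F_a)) /
      (2 * η * (1 - η) * A))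
    (K : ℝ) (hK : K = Real.sqrt ((A * N - B) ^ 2 - 4 * A * F_a))
    (c : ℝ → ℝ)
    (hc : ∀ x, c x = (A / (1 - θ)) * (N - (1 - κ) * x) + t_f + F_n)
    (SCMC SC2 SCm SC0 : ℝ)
    (hSCMC : SCMC = N * c ((A * N - B) / A) + F_a)
    (hSC2 : SC2 = N * c ((A * N - B + K) / (2 * A)))
    (hSCm : SCm = N * c ((A * N - B) / (2 * A)) - (A * N - B) ^ 2 / (4 * A) + F_a)
    (hSC0 : SC0 = N * c 0 + F_a) :
    (Nmin < N → N < Nc → SCMC < SC2 ∧ SC2 < SCm ∧ SCm < SC0) ∧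
    (N = Nc → SCMC = SC2 ∧ SC2 < SCm ∧ SCm < SC0) ∧
    (N > Nc → SC2 < SCMC ∧ SCMC < SCm ∧ SCm < SC0) := by
  have h1θ : 0 < 1 - θ := by linarith
  have hA0 : 0 < A := by rw [hA]; positivity
  have hη0 : 0 < η := by linarith
  have h1η : 0 < 1 - η := by linarith
  have hκη : 1 - κ = η * (1 - θ) := by rw [hη]; field_simp
  obtain ⟨D, hD⟩ : ∃ D, D = A * N - B := ⟨_, rfl⟩
  have hD0 : 0 < D := by linarith
  have hAF : 0 < A * F_a := by positivity
  have hDF : 0 < D ^ 2 - 4 * A * F_a := by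
    have h1 : (B + 2 * Real.sqrt (A * F_a)) < N * A := by
      rw [hNmin, gt_iff_lt, div_lt_iff₀ hA0] at hNlarge
      exact hNlarge
    have h2 : 2 * Real.sqrt (A * F_a) < D := by linarith
    have h3 := Real.sq_sqrt hAF.le
    have h4 := Real.sqrt_nonneg (A * F_a)
    nlinarith
  rw [← hD] at hK hSCMC hSC2 hSCm
  have hK0 : 0 < K := by rw [hK]; exact Real.sqrt_pos.mpr hDF
  have hK2 : K ^ 2 = D ^ 2 - 4 * A * F_a := by rw [hK]; exact Real.sq_sqrt hDF.le
  have hKD : K < D := by nlinarith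
  have hAN : 0 < A * N := by positivity
  have hL : A * N ≤ 2 * (A * N) * η := by nlinarith
  have hcx : ∀ x, N * c x = N * c 0 - N * A * η * x := by
    intro x
    rw [hc, hc, hκη]
    field_simp
    ring
  rw [hcx] at hSCMC hSC2 hSCm
  have e0 : (SC0 - SCm) * (4 * A) = 2 * A * N * η * D + D ^ 2 := by
    rw [hSC0, hSCm]; field_simp; ring
  have e1 : (SCm - SC2) * (4 * A) = K * (2 * (A * N) * η - K) := by
    have : (SCm - SC2) * (4 * A) = 2 * (A * N) * η * K - (D ^ 2 - 4 * A * F_a) := by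
      rw [hSC2, hSCm]; field_simp; ring
    rw [this, ← hK2]; ring
  have e2 : (SCm - SCMC) * (4 * A) = D * (2 * (A * N) * η - D) := by
    rw [hSCMC, hSCm]; field_simp; ring
  have e3 : (SC2 - SCMC) * (4 * A) = (D - K) * (2 * (A * N) * η - D - K) := by
    have : (SC2 - SCMC) * (4 * A) = 2 * (A * N) * η * (D - K) - 4 * A * F_a := by
      rw [hSC2, hSCMC]; field_simp; ring
    rw [this]; linear_combination -hK2
  have h4A : 0 < 4 * A := by linarith
  have g0 : SCm < SC0 := by
    have : 0 < (SC0 - SCm) * (4 * A) := by rw [e0]; positivity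
    linarith [pos_of_mul_pos_left this h4A.le]
  have g1 : SC2 < SCm := by
    have : 0 < (SCm - SC2) * (4 * A) := by rw [e1]; exact mul_pos hK0 (by linarith)
    linarith [pos_of_mul_pos_left this h4A.le]
  have g2 : SCMC < SCm := by
    have : 0 < (SCm - SCMC) * (4 * A) := by rw [e2]; exact mul_pos hD0 (by linarith)
    linarith [pos_of_mul_pos_left this h4A.le]
  obtain ⟨a, ha⟩ : ∃ a, a = η * (1 - η) * A := ⟨_, rfl⟩
  have ha0 : 0 < a := by rw [ha]; positivity
  have hR : 0 < η ^ 2 * B ^ 2 + 4 * η * (1 - η) * A * F_a := by positivity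
  obtain ⟨S, hS⟩ : ∃ S, S = Real.sqrt (η ^ 2 * B ^ 2 + 4 * η * (1 - η) * A * F_a) := ⟨_, rfl⟩
  have hS0 : 0 ≤ S := by rw [hS]; exact Real.sqrt_nonneg _
  have hS2 : S ^ 2 = η ^ 2 * B ^ 2 + 4 * a * F_a := by
    rw [hS, Real.sq_sqrt hR.le, ha]; ring
  have hSB : η * B < S := by
    have : 0 < a * F_a := by positivity
    apply lt_of_pow_lt_pow_left₀ 2 hS0
    nlinarith
  have hNc' : 2 * a * Nc = η * B + S := by
    rw [hNc, ← hS, ha]; field_simp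
  obtain ⟨P, hP⟩ : ∃ P, P = 2 * a * N - η * B + S := ⟨_, rfl⟩
  have hP0 : 0 < P := by
    have : 0 < a * N := by positivity
    linarith
  have hLK : 0 < 2 * (A * N) * η - D + K := by linarith
  have key : (2 * (A * N) * η - D - K) * ((2 * (A * N) * η - D + K) * a)
      = A * (2 * a * (Nc - N)) * P := by
    have h2 : 2 * a * (Nc - N) * P = 4 * a * (F_a + η * B * N - a * N ^ 2) := by
      rw [mul_sub, hNc', hP]; linear_combination hS2
    have h3 : (2 * (A * N) * η - D - K) * (2 * (A * N) * η - D + K)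
        = 4 * A * (F_a + η * B * N - a * N ^ 2) := by
      rw [ha]; subst hD; linear_combination -hK2
    linear_combination a * h3 - A * h2
  have fin : (SC2 - SCMC) * (4 * A * ((2 * (A * N) * η - D + K) * a))
      = (Nc - N) * ((D - K) * A * (2 * a) * P) := by
    linear_combination ((2 * (A * N) * η - D + K) * a) * e3 + (D - K) * key
  have hDK : 0 < D - K := by linarith
  obtain ⟨X, hX⟩ : ∃ X, X = 4 * A * ((2 * (A * N) * η - D + K) * a) := ⟨_, rfl⟩
  obtain ⟨Y, hY⟩ : ∃ Y, Y = (D - K) * A * (2 * a) * P := ⟨_, rfl⟩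
  have hX0 : 0 < X := by rw [hX]; positivity
  have hY0 : 0 < Y := by rw [hY]; positivity
  rw [← hX, ← hY] at fin
  refine ⟨fun _ h => ⟨?_, g1, g0⟩, fun h => ⟨?_, g1, g0⟩, fun h => ⟨?_, g2, g0⟩⟩
  · have : 0 < (SC2 - SCMC) * X := by rw [fin]; exact mul_pos (by linarith) hY0
    linarith [pos_of_mul_pos_left this hX0.le]
  · rw [h, sub_self, zero_mul] at fin
    rcases mul_eq_zero.mp fin with h' | h' <;> linarith
  · have : 0 < (SCMC - SC2) * X := by
      have : (SCMC - SC2) * X = (N - Nc) * Y := by linear_combination -fin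
      rw [this]; exact mul_pos (by linarith) hY0
    linarith [pos_of_mul_pos_left this hX0.le]
end

section
/- Assume 0 < η < 1/2 where η := (1−κ)/(1−θ), and define F_{a,c} := η²·B²/((1−2η)²·A), N_c^{AC=m} := (B + √(4·η²·B² + 4·(1−4·η²)·A·F_a))/((1−4·η²)·A), N_c^{MC=m} := B/((1−2η)·A), and N_c^{MC=AC} := (η·B + √(η²·B² + 4·η·(1−η)·A·F_a))/(2·η·(1−η)·A). If F_a ≥ F_{a,c}, then: for N_min < N < N_c^{AC=m}, SC_2 < SC^m < SC^MC < SC_0; and for N ≥ N_c^{AC=m}, SC^m ≤ SC_2 < SC^MC < SC_0. If F_a < F_{a,c}, then: for N_min < N < N_c^{MC=AC}, SC^MC < SC_2 < SC^m < SC_0; for N_c^{MC=AC} ≤ N < N_c^{MC=m}, SC_2 ≤ SC^MC < SC^m < SC_0; for N_c^{MC=m} ≤ N < N_c^{AC=m}, SC_2 < SC^m ≤ SC^MC < SC_0; and for N ≥ N_c^{AC=m}, SC^m ≤ SC_2 < SC^MC < SC_0. -/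
set_option maxHeartbeats 4000000 in
/-- Assume `0 < η < 1/2` with `η := (1−κ)/(1−θ)`, and define the
critical fixed cost `F_{a,c}` and critical population levels `N_c^{AC=m}`,
`N_c^{MC=m}`, `N_c^{MC=AC}`. If `F_a ≥ F_{a,c}`, then: for
`N_min < N < N_c^{AC=m}`, `SC_2 < SC^m < SC^MC < SC_0`; and for
`N ≥ N_c^{AC=m}`, `SC^m ≤ SC_2 < SC^MC < SC_0`. If `F_a < F_{a,c}`, then: for
`N_min < N < N_c^{MC=AC}`, `SC^MC < SC_2 < SC^m < SC_0`; for
`N_c^{MC=AC} ≤ N < N_c^{MC=m}`, `SC_2 ≤ SC^MC < SC^m < SC_0`; for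
`N_c^{MC=m} ≤ N < N_c^{AC=m}`, `SC_2 < SC^m ≤ SC^MC < SC_0`; and for
`N ≥ N_c^{AC=m}`, `SC^m ≤ SC_2 < SC^MC < SC_0`. -/
theorem stmt_18
    (β γ μ t_f F_n m F_a N θ κ : ℝ)
    (hβ : 0 < β) (hγ : 0 < γ) (hμ : 0 < μ) (hFa : 0 < F_a) (hN : 0 < N)
    (hθ0 : 0 < θ) (hθ1 : θ < 1) (hκ0 : 0 < κ) (hκ1 : κ < 1)
    (A B : ℝ)
    (hA : A = β * γ * (1 - θ) / ((β + γ) * μ))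
    (hB : B = θ * t_f + m - (t_f + F_n))
    (hB0 : 0 < B) (hBA : B < A * N)
    (η : ℝ) (hη : η = (1 - κ) / (1 - θ)) (hη1 : 0 < η) (hη2 : η < 1 / 2)
    (Nmin : ℝ) (hNmin : Nmin = (B + 2 * Real.sqrt (A * F_a)) / A)
    (hNlarge : N > Nmin)
    (Fac NcACm NcMCm NcMCAC : ℝ)
    (hFac : Fac = η ^ 2 * B ^ 2 / ((1 - 2 * η) ^ 2 * A))
    (hNcACm : NcACm = (B + Real.sqrt (4 * η ^ 2 * B ^ 2 + 4 * (1 - 4 * η ^ 2) * A * F_a)) /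
      ((1 - 4 * η ^ 2) * A))
    (hNcMCm : NcMCm = B / ((1 - 2 * η) * A))
    (hNcMCAC : NcMCAC = (η * B + Real.sqrt (η ^ 2 * B ^ 2 + 4 * η * (1 - η) * A * F_a)) /
      (2 * η * (1 - η) * A))
    (K : ℝ) (hK : K = Real.sqrt ((A * N - B) ^ 2 - 4 * A * F_a))
    (c : ℝ → ℝ)
    (hc : ∀ x, c x = (A / (1 - θ)) * (N - (1 - κ) * x) + t_f + F_n)
    (SCMC SC2 SCm SC0 : ℝ)
    (hSCMC : SCMC = N * c ((A * N - B) / A) + F_a)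
    (hSC2 : SC2 = N * c ((A * N - B + K) / (2 * A)))
    (hSCm : SCm = N * c ((A * N - B) / (2 * A)) - (A * N - B) ^ 2 / (4 * A) + F_a)
    (hSC0 : SC0 = N * c 0 + F_a) :
    (F_a ≥ Fac →
      (Nmin < N → N < NcACm → SC2 < SCm ∧ SCm < SCMC ∧ SCMC < SC0) ∧
      (N ≥ NcACm → SCm ≤ SC2 ∧ SC2 < SCMC ∧ SCMC < SC0)) ∧
    (F_a < Fac →
      (Nmin < N → N < NcMCAC → SCMC < SC2 ∧ SC2 < SCm ∧ SCm < SC0) ∧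
      (NcMCAC ≤ N → N < NcMCm → SC2 ≤ SCMC ∧ SCMC < SCm ∧ SCm < SC0) ∧
      (NcMCm ≤ N → N < NcACm → SC2 < SCm ∧ SCm ≤ SCMC ∧ SCMC < SC0) ∧
      (N ≥ NcACm → SCm ≤ SC2 ∧ SC2 < SCMC ∧ SCMC < SC0)) := by
  have hθ : 0 < 1 - θ := by linarith
  have hA0 : 0 < A := by rw [hA]; positivity
  have hcx : ∀ x, c x = (A / (1 - θ)) * N + t_f + F_n - A * η * x := by
    intro x; rw [hc, hη]; field_simp; ring
  obtain ⟨n, hn⟩ : ∃ n, n = A * N := ⟨_, rfl⟩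
  obtain ⟨f, hf⟩ : ∃ f, f = A * F_a := ⟨_, rfl⟩
  obtain ⟨D, hD⟩ : ∃ D, D = n - B := ⟨_, rfl⟩
  obtain ⟨C, hC⟩ : ∃ C, C = A * (N * ((A / (1 - θ)) * N + t_f + F_n)) := ⟨_, rfl⟩
  have hf0 : 0 < f := by rw [hf]; positivity
  have hn0 : 0 < n := by rw [hn]; positivity
  have hD0 : 0 < D := by rw [hD, hn]; linarith
  have hDn : A * N - B = D := by rw [hD, hn]
  have e1 : A * SCMC = C - n * η * D + f := by
    rw [hSCMC, hcx, hC, hf, hn, hDn]; field_simp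
  have e2 : A * SC2 = C - n * η * (D + K) / 2 := by
    rw [hSC2, hcx, hC, hn, hDn]; field_simp
  have e3 : A * SCm = C - n * η * D / 2 - D ^ 2 / 4 + f := by
    rw [hSCm, hcx, hC, hf, hn, hDn]; field_simp
  have e4 : A * SC0 = C + f := by
    rw [hSC0, hcx, hC, hf]; ring
  have hlt : ∀ x y, x < y ↔ A * x < A * y := fun x y => (mul_lt_mul_iff_right₀ hA0).symm
  have hle : ∀ x y, x ≤ y ↔ A * x ≤ A * y := fun x y => (mul_le_mul_iff_right₀ hA0).symm
  obtain ⟨r, hr⟩ : ∃ r, r = Real.sqrt f := ⟨_, rfl⟩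
  have hr0 : 0 < r := by rw [hr]; exact Real.sqrt_pos.2 hf0
  have hr2 : r ^ 2 = f := by rw [hr]; exact Real.sq_sqrt hf0.le
  have hDr : 2 * r < D := by
    rw [hNmin, ← hf, ← hr, gt_iff_lt, div_lt_iff₀ hA0] at hNlarge
    rw [hD, hn]; linarith
  have hKp : 0 < D ^ 2 - 4 * f := by
    have h : 0 < (D - 2 * r) * (D + 2 * r) := mul_pos (by linarith) (by linarith)
    rw [← hr2]; linarith
  have hKe : K = Real.sqrt (D ^ 2 - 4 * f) := by rw [hK, hDn, hf]; ring_nf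
  have hK0 : 0 < K := by rw [hKe]; exact Real.sqrt_pos.2 hKp
  have hK2 : K ^ 2 = D ^ 2 - 4 * f := by rw [hKe]; exact Real.sq_sqrt hKp.le
  have hKD : K < D := lt_of_pow_lt_pow_left₀ 2 hD0.le (by linarith)
  have hnη : 0 < n * η := by positivity
  have hMC0 : SCMC < SC0 := by
    rw [hlt, e1, e4]; linarith [mul_pos hnη hD0, pow_pos hD0 2]
  have hm0 : SCm < SC0 := by
    rw [hlt, e3, e4]; linarith [mul_pos hnη hD0, pow_pos hD0 2]
  have d2m : A * SCm - A * SC2 = K / 4 * (2 * (n * η) - K) := by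
    rw [e2, e3]; linear_combination (1 / 4) * hK2
  have d2M : A * SCMC - A * SC2 = (D - K) / 4 * (D + K - 2 * (n * η)) := by
    rw [e2, e1]; linear_combination (1 / 4) * hK2
  have dmM : A * SCMC - A * SCm = D / 4 * (D - 2 * (n * η)) := by
    rw [e3, e1]; ring
  have hK4 : 0 < K / 4 := by linarith
  have hD4 : 0 < D / 4 := by linarith
  have hDK4 : 0 < (D - K) / 4 := by linarith
  have l2m : K < 2 * (n * η) → SC2 < SCm := fun h => by
    rw [hlt]; linarith [mul_pos hK4 (sub_pos.2 h)]
  have lm2 : 2 * (n * η) ≤ K → SCm ≤ SC2 := fun h => by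
    rw [hle]; linarith [mul_nonneg hK4.le (sub_nonneg.2 h)]
  have l2M : 2 * (n * η) < D + K → SC2 < SCMC := fun h => by
    rw [hlt]; linarith [mul_pos hDK4 (sub_pos.2 h)]
  have l2M' : 2 * (n * η) ≤ D + K → SC2 ≤ SCMC := fun h => by
    rw [hle]; linarith [mul_nonneg hDK4.le (sub_nonneg.2 h)]
  have lM2 : D + K < 2 * (n * η) → SCMC < SC2 := fun h => by
    rw [hlt]; linarith [mul_pos hDK4 (sub_pos.2 h)]
  have lmM : 2 * (n * η) < D → SCm < SCMC := fun h => by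
    rw [hlt]; linarith [mul_pos hD4 (sub_pos.2 h)]
  have lmM' : 2 * (n * η) ≤ D → SCm ≤ SCMC := fun h => by
    rw [hle]; linarith [mul_nonneg hD4.le (sub_nonneg.2 h)]
  have lMm : D < 2 * (n * η) → SCMC < SCm := fun h => by
    rw [hlt]; linarith [mul_pos hD4 (sub_pos.2 h)]
  have h2η : 0 < 1 - 2 * η := by linarith
  have h4η : 0 < 1 - 4 * η ^ 2 := by
    have := mul_pos h2η (by linarith : 0 < 1 + 2 * η)
    linarith
  have h1η : 0 < 1 - η := by linarith
  -- threshold AC = m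
  obtain ⟨S, hS⟩ : ∃ S, S = Real.sqrt (4 * η ^ 2 * B ^ 2 + 4 * (1 - 4 * η ^ 2) * A * F_a) :=
    ⟨_, rfl⟩
  have hS0 : 0 ≤ S := by rw [hS]; exact Real.sqrt_nonneg _
  have hS2 : S ^ 2 = 4 * η ^ 2 * B ^ 2 + 4 * (1 - 4 * η ^ 2) * f := by
    rw [hS, Real.sq_sqrt (by positivity), hf]; ring
  have qS : ((1 - 4 * η ^ 2) * n - B) ^ 2 - S ^ 2
      = (1 - 4 * η ^ 2) * (K ^ 2 - (2 * (n * η)) ^ 2) := by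
    rw [hS2, hK2, hD]; ring
  have hT : N < NcACm ↔ (1 - 4 * η ^ 2) * n - B < S := by
    rw [hNcACm, ← hS, lt_div_iff₀ (by positivity), hn]
    constructor <;> intro h <;> linarith
  have tAm : N < NcACm → K < 2 * (n * η) := by
    rw [hT]; intro h
    by_contra hc'
    push Not at hc'
    have h1 : 0 ≤ K ^ 2 - (2 * (n * η)) ^ 2 := sub_nonneg.2 (pow_le_pow_left₀ (by positivity) hc' 2)
    have h2 : S ^ 2 ≤ ((1 - 4 * η ^ 2) * n - B) ^ 2 := by linarith [mul_nonneg h4η.le h1]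
    have h3 : (1 - 4 * η ^ 2) * n - B ≤ -S := by
      by_contra h4
      push Not at h4
      linarith [sq_lt_sq' h4 h]
    have h4 : 2 * (n * η) ≤ D := by linarith
    -- (1-4η²) n - B = D - 4η² n, and 4η² n ≤ 2η D < D
    have h5 : 2 * η * (2 * (n * η)) ≤ 2 * η * D := mul_le_mul_of_nonneg_left h4 (by linarith)
    linarith [mul_pos h2η hD0]
  have tAm' : N ≥ NcACm → 2 * (n * η) ≤ K := by
    rw [ge_iff_le, ← not_lt, hT, not_lt]; intro h
    by_contra hc'
    push Not at hc'
    have h1 : 0 < (2 * (n * η)) ^ 2 - K ^ 2 := sub_pos.2 (pow_lt_pow_left₀ hc' hK0.le two_ne_zero)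
    linarith [mul_pos h4η h1, pow_le_pow_left₀ hS0 h 2]
  have tM : N < NcMCm ↔ D < 2 * (n * η) := by
    rw [hNcMCm, lt_div_iff₀ (by positivity), hD, hn]
    constructor <;> intro h <;> linarith
  -- threshold MC = AC
  obtain ⟨R, hR⟩ : ∃ R, R = Real.sqrt (η ^ 2 * B ^ 2 + 4 * η * (1 - η) * A * F_a) :=
    ⟨_, rfl⟩
  have hR0 : 0 ≤ R := by rw [hR]; exact Real.sqrt_nonneg _
  have hR2 : R ^ 2 = η ^ 2 * B ^ 2 + 4 * η * (1 - η) * f := by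
    rw [hR, Real.sq_sqrt (by positivity), hf]; ring
  have hηη : 0 < η * (1 - η) := by positivity
  have qR : R ^ 2 - (2 * η * (1 - η) * n - η * B) ^ 2
      = (η * (1 - η)) * ((2 * (n * η) - D) ^ 2 - K ^ 2) := by
    rw [hR2, hK2, hD]; ring
  have hU : N < NcMCAC ↔ 2 * η * (1 - η) * n - η * B < R := by
    rw [hNcMCAC, ← hR, lt_div_iff₀ (by positivity), hn]
    constructor <;> intro h <;> linarith
  have hnB : B < n := by linarith
  have hpos : 0 < 2 * η * (1 - η) * n - η * B := by
    linarith [mul_pos hη1 (sub_pos.2 hnB), mul_pos (mul_pos hη1 h2η) hn0]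
  have tMA : N < NcMCAC → K ^ 2 < (2 * (n * η) - D) ^ 2 := by
    rw [hU]; intro h
    have h1 : 0 < (η * (1 - η)) * ((2 * (n * η) - D) ^ 2 - K ^ 2) := by 
      rw [← qR]; exact sub_pos.2 (pow_lt_pow_left₀ h hpos.le two_ne_zero)
    linarith [pos_of_mul_pos_right h1 hηη.le]
  have tMA' : NcMCAC ≤ N → (2 * (n * η) - D) ^ 2 ≤ K ^ 2 := by
    rw [← not_lt, hU, not_lt]; intro h
    by_contra hc'
    push Not at hc'
    linarith [mul_pos hηη (sub_pos.2 hc'), pow_le_pow_left₀ hR0 h 2]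
  have tF : F_a < Fac ↔ f * (1 - 2 * η) ^ 2 < η ^ 2 * B ^ 2 := by
    rw [hFac, lt_div_iff₀ (by positivity), hf]
    constructor <;> intro h <;> linarith
  refine ⟨fun hF => ?_, fun hF => ?_⟩
  · rw [ge_iff_le, ← not_lt, tF, not_lt, ← hr2] at hF
    have h1 : η * B ≤ r * (1 - 2 * η) := by
      exact abs_le_of_sq_le_sq' (by linarith) (by positivity) |>.2
    have h2 : 2 * (n * η) < D := by
      have := mul_pos h2η (sub_pos.2 hDr)
      rw [hD] at this ⊢
      linarith
    exact ⟨fun _ h => ⟨l2m (tAm h), lmM h2, hMC0⟩,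
      fun h => ⟨lm2 (tAm' h), l2M (by linarith), hMC0⟩⟩
  · rw [tF] at hF
    refine ⟨fun _ h => ?_, fun h h' => ?_, fun h h' => ?_, fun h => ?_⟩
    · have h1 := tMA h
      have h2 : D < 2 * (n * η) := by
        by_contra h3
        push Not at h3
        have h4 : B ≤ (1 - 2 * η) * n := by linarith
        have h5 : K ^ 2 - (2 * (n * η) - D) ^ 2 = 4 * (η * n * ((1 - η) * n - B) - f) := by
          rw [hK2, hD]; ring
        have h6 : η * n ≤ (1 - η) * n - B := by linarith
        have h7 : (η * n) ^ 2 ≤ η * n * ((1 - η) * n - B) := by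
          rw [pow_two]; exact mul_le_mul_of_nonneg_left h6 (by positivity)
        have h8 : (η * B) ^ 2 ≤ (η * ((1 - 2 * η) * n)) ^ 2 := by gcongr
        have h9 : f * (1 - 2 * η) ^ 2 < (η * n) ^ 2 * (1 - 2 * η) ^ 2 := by linarith
        have h10 := lt_of_mul_lt_mul_right h9 (by positivity)
        linarith
      have h3 : K < 2 * (n * η) - D := lt_of_pow_lt_pow_left₀ 2 (by linarith) h1
      exact ⟨lM2 (by linarith), l2m (by linarith), hm0⟩
    · have h1 := tM.1 h'
      have h3 : 2 * (n * η) - D ≤ K := (abs_le_of_sq_le_sq' (tMA' h) hK0.le).2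
      exact ⟨l2M' (by linarith), lMm h1, hm0⟩
    · have h1 : 2 * (n * η) ≤ D := by
        rw [← not_lt, tM, not_lt] at h; exact h
      exact ⟨l2m (tAm h'), lmM' h1, hMC0⟩
    · have h1 := tAm' h
      exact ⟨lm2 h1, l2M (by linarith), hMC0⟩
end

section
/- Assume (A·N − B)² − 4·A·F_a ≥ 0 and let η := (1−κ)/(1−θ). Then the following exact identities hold: SC^m − SC^MC = ((A·N − B)/(4A))·((2η − 1)·A·N + B); SC^m − SC_2 = K·(2·η·A·N − K)/(4A); and SC_2 − SC^MC = (η/2)·(A·N − B − K)·N − F_a = F_a·(2·η·A·N/(A·N − B + K) − 1). -/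
/-- Assume `(A·N − B)² − 4·A·F_a ≥ 0` and let
`η := (1−κ)/(1−θ)`. Then the following exact identities hold:
`SC^m − SC^MC = ((A·N − B)/(4A))·((2η − 1)·A·N + B)`;
`SC^m − SC_2 = K·(2·η·A·N − K)/(4A)`; and
`SC_2 − SC^MC = (η/2)·(A·N − B − K)·N − F_a = F_a·(2·η·A·N/(A·N − B + K) − 1)`. -/
theorem stmt_19
    (β γ μ t_f F_n m F_a N θ κ : ℝ)
    (hβ : 0 < β) (hγ : 0 < γ) (hμ : 0 < μ) (hFa : 0 < F_a) (hN : 0 < N)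
    (hθ0 : 0 < θ) (hθ1 : θ < 1) (hκ0 : 0 < κ) (hκ1 : κ < 1)
    (A B : ℝ)
    (hA : A = β * γ * (1 - θ) / ((β + γ) * μ))
    (hB : B = θ * t_f + m - (t_f + F_n))
    (hB0 : 0 < B) (hBA : B < A * N)
    (hdisc : (A * N - B) ^ 2 - 4 * A * F_a ≥ 0)
    (η : ℝ) (hη : η = (1 - κ) / (1 - θ))
    (K : ℝ) (hK : K = Real.sqrt ((A * N - B) ^ 2 - 4 * A * F_a))
    (c : ℝ → ℝ)
    (hc : ∀ x, c x = (A / (1 - θ)) * (N - (1 - κ) * x) + t_f + F_n)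
    (SCMC SC2 SCm : ℝ)
    (hSCMC : SCMC = N * c ((A * N - B) / A) + F_a)
    (hSC2 : SC2 = N * c ((A * N - B + K) / (2 * A)))
    (hSCm : SCm = N * c ((A * N - B) / (2 * A)) - (A * N - B) ^ 2 / (4 * A) + F_a) :
    SCm - SCMC = ((A * N - B) / (4 * A)) * ((2 * η - 1) * A * N + B) ∧
    SCm - SC2 = K * (2 * η * A * N - K) / (4 * A) ∧
    SC2 - SCMC = (η / 2) * (A * N - B - K) * N - F_a ∧
    SC2 - SCMC = F_a * (2 * η * A * N / (A * N - B + K) - 1) := by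
  have hA0 : 0 < A := by
    by_contra h
    nlinarith [mul_nonneg (sub_nonneg.2 (not_lt.1 h)) hN.le]
  have hAne : A ≠ 0 := hA0.ne'
  have hK0 : 0 ≤ K := hK ▸ Real.sqrt_nonneg _
  have hK2 : K ^ 2 = (A * N - B) ^ 2 - 4 * A * F_a := by
    rw [hK]; exact Real.sq_sqrt hdisc
  have hc' : ∀ x, c x = A / (1 - θ) * N - η * (A * x) + t_f + F_n := by
    intro x
    rw [hc, hη]
    ring
  have hD0 : 0 < A * N - B := by linarith
  have e1 : A * ((A * N - B) / A) = A * N - B := by field_simp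
  have e2 : A * ((A * N - B + K) / (2 * A)) = (A * N - B + K) / 2 := by field_simp
  have e3 : A * ((A * N - B) / (2 * A)) = (A * N - B) / 2 := by field_simp
  rw [hc', e1] at hSCMC
  rw [hc', e2] at hSC2
  rw [hc', e3] at hSCm
  have hF : F_a = ((A * N - B) ^ 2 - K ^ 2) / (4 * A) := by
    rw [hK2]; field_simp; ring
  have h3 : SC2 - SCMC = (η / 2) * (A * N - B - K) * N - F_a := by
    rw [hSC2, hSCMC]; ring
  refine ⟨?_, ?_, h3, ?_⟩
  · rw [hSCm, hSCMC]; field_simp; ring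
  · rw [hSCm, hSC2, hF]; field_simp; ring
  · have hs : A * N - B + K ≠ 0 := by positivity
    have : F_a * (2 * η * A * N / (A * N - B + K)) = (η / 2) * (A * N - B - K) * N := by
      rw [← mul_div_assoc, div_eq_iff hs]
      linear_combination (η * N / 2) * hK2
    linear_combination h3 - this
end
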